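/- Let P(b, b_x) = −b³b²b_x² − b¹b³b_x⁴ + b¹b²b_x⁵ − b¹b⁶ − (b³)². Then for every smooth curve b: ℝ → ℝ⁶ with b'¹(x) ≠ 0 for all x, and for all i ∈ {1, …, 6} and all x, −Σ_{β,γ,s} φ^{βγ} ψ^i_β(b'(x)) · (d/dx)[ψ^s_γ(b'(x)) E_s(P)(x)] = b'^i(x). That is, ∫ P dx is the common momentum of the six-component WDVV hydrodynamic type systems with respect to the factorised third-order Hamiltonian operator determined by Ψ and Φ. -/

import Mathlib

open scoped BigOperators

/-- Euler–Lagrange (variational) derivative of a density `h(b, b_x)` along a curve `b`. -/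
noncomputable def ELd (h : (Fin 6 → ℝ) → (Fin 6 → ℝ) → ℝ)
    (b : ℝ → Fin 6 → ℝ) (s : Fin 6) (x : ℝ) : ℝ :=
  fderiv ℝ (fun u => h u (deriv b x)) (b x) (Pi.single s 1)
  - deriv (fun y => fderiv ℝ (fun v => h (b y) v) (deriv b y) (Pi.single s 1)) x

/-- The matrix Ψ(a) = (ψ^γ_i(a)) (row index i, column index γ). -/
noncomputable def ΨW (a : Fin 6 → ℝ) : Matrix (Fin 6) (Fin 6) ℝ :=
  !![1, a 4, a 3, 0, 0, 0;
     0, a 2, 0, 1, a 4, 0;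
     0, -a 1, 0, 0, -a 3, 1;
     0, 0, -a 0, 0, a 2, 0;
     0, -a 0, 0, 0, -a 1, 0;
     0, 0, 0, 0, -1, 0]

/-- The constant symmetric matrix Φ = (φ_{βγ}). -/
noncomputable def ΦW : Matrix (Fin 6) (Fin 6) ℝ :=
  !![0, 0, 0, 0, -1, 0;
     0, 0, 0, -1, 0, 0;
     0, 0, 1, 0, 0, 1;
     0, -1, 0, 0, 0, 0;
     -1, 0, 0, 0, 0, 0;
     0, 0, 1, 0, 0, 2]

/-- The momentum density P of the six-component WDVV hydrodynamic type systems. -/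
noncomputable def PW (b bx : Fin 6 → ℝ) : ℝ :=
  -(b 2)*(b 1)*(bx 1) - (b 0)*(b 2)*(bx 3) + (b 0)*(b 1)*(bx 4) - (b 0)*(b 5)
    - (b 2)^2

/-- The inverse of `ΨW a`, valid when `a 0 ≠ 0`. -/
noncomputable def ΨWInv (a : Fin 6 → ℝ) : Matrix (Fin 6) (Fin 6) ℝ :=
  !![1, 0, 0, a 3 / a 0, a 4 / a 0, (a 3 * a 2 - a 4 * a 1) / a 0;
     0, 0, 0, 0, -1 / a 0, a 1 / a 0;
     0, 0, 0, -1 / a 0, 0, -a 2 / a 0;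
     0, 1, 0, 0, a 2 / a 0, a 4 - a 1 * a 2 / a 0;
     0, 0, 0, 0, 0, -1;
     0, 0, 1, 0, -a 1 / a 0, a 1 ^ 2 / a 0 - a 3]

theorem ΨW_mul_ΨWInv {a : Fin 6 → ℝ} (ha : a 0 ≠ 0) : ΨW a * ΨWInv a = 1 := by
  ext i j
  fin_cases i <;> fin_cases j <;>
    simp [ΨW, ΨWInv, Matrix.mul_apply, Fin.sum_univ_succ] <;> field_simp <;> ring

theorem ΨW_inv {a : Fin 6 → ℝ} (ha : a 0 ≠ 0) : (ΨW a)⁻¹ = ΨWInv a :=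
  Matrix.inv_eq_right_inv (ΨW_mul_ΨWInv ha)

theorem ΦW_inv : ΦW⁻¹ =
    !![0, 0, 0, 0, -1, 0;
       0, 0, 0, -1, 0, 0;
       0, 0, 2, 0, 0, -1;
       0, -1, 0, 0, 0, 0;
       -1, 0, 0, 0, 0, 0;
       0, 0, -1, 0, 0, 1] := by
  refine Matrix.inv_eq_right_inv ?_
  ext i j
  fin_cases i <;> fin_cases j <;>
    norm_num [ΦW, Matrix.mul_apply, Fin.sum_univ_succ]

theorem fderiv_PW_left (a p w : Fin 6 → ℝ) :
    fderiv ℝ (fun u => PW u a) p w =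
      -(p 2 * w 1 + p 1 * w 2) * a 1 - (p 0 * w 2 + p 2 * w 0) * a 3
        + (p 0 * w 1 + p 1 * w 0) * a 4 - (p 0 * w 5 + p 5 * w 0) - 2 * p 2 * w 2 := by
  have h (i : Fin 6) := hasFDerivAt_apply (𝕜 := ℝ) (F' := fun _ : Fin 6 => ℝ) i p
  have := ((((((h 2).neg.mul (h 1)).mul_const (a 1)).sub
    (((h 0).mul (h 2)).mul_const (a 3))).add (((h 0).mul (h 1)).mul_const (a 4))).sub
    ((h 0).mul (h 5))).sub ((h 2).pow 2)
  have h' := congrArg (fun L => L w) this.fderiv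
  refine Eq.trans h' ?_
  simp
  ring

theorem fderiv_PW_right (p a w : Fin 6 → ℝ) :
    fderiv ℝ (fun v => PW p v) a w =
      -p 2 * p 1 * w 1 - p 0 * p 2 * w 3 + p 0 * p 1 * w 4 := by
  have h (i : Fin 6) := hasFDerivAt_apply (𝕜 := ℝ) (F' := fun _ : Fin 6 => ℝ) i a
  have := (((((h 1).const_mul (-p 2 * p 1)).sub ((h 3).const_mul (p 0 * p 2))).add
    ((h 4).const_mul (p 0 * p 1))).sub_const (p 0 * p 5)).sub_const (p 2 ^ 2)
  have h' := congrArg (fun L => L w) this.fderiv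
  refine Eq.trans h' ?_
  simp

/-- The variational derivative of the momentum density in closed form. -/
theorem ELd_PW {b : ℝ → Fin 6 → ℝ} (hb : Differentiable ℝ b) (s : Fin 6) (x : ℝ) :
    ELd PW b s x =
      ![-b x 2 * deriv b x 3 + b x 1 * deriv b x 4 - b x 5,
        b x 0 * deriv b x 4 + b x 1 * deriv b x 2,
        -b x 1 * deriv b x 1 - b x 0 * deriv b x 3 - 2 * b x 2,
        b x 0 * deriv b x 2 + b x 2 * deriv b x 0,
        -b x 0 * deriv b x 1 - b x 1 * deriv b x 0,
        -b x 0] s := by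
  have h (i : Fin 6) : HasDerivAt (fun y => b y i) (deriv b x i) x :=
    hasDerivAt_pi.1 (hb x).hasDerivAt i
  have h21 := ((h 2).neg.mul (h 1)).deriv
  have h02 := ((h 0).mul (h 2)).neg.deriv
  have h01 := ((h 0).mul (h 1)).deriv
  simp only [ELd, fderiv_PW_left, fderiv_PW_right]
  simp only [Pi.mul_def, Pi.neg_def] at h21 h02 h01
  fin_cases s
  · simp
  · simp [-neg_mul, h21]; ring
  · simp
  · simp at h02 ⊢; linarith
  · simp [h01]; ring
  · simp

/-- Contracting the variational derivative with `Ψ⁻¹` gives a linear expression in the curve. -/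
theorem sum_ΨW_inv_mul_ELd_PW {b : ℝ → Fin 6 → ℝ} (hb : Differentiable ℝ b) {x : ℝ}
    (hx : deriv b x 0 ≠ 0) (γ : Fin 6) :
    ∑ s, (ΨW (deriv b x))⁻¹ γ s * ELd PW b s x =
      ![-b x 5, b x 1, -b x 2, 0, b x 0, -2 * b x 2] γ := by
  simp only [ELd_PW hb, ΨW_inv hx]
  fin_cases γ <;> simp [ΨWInv, Fin.sum_univ_succ] <;> field_simp <;> ring

/-- ∫ P dx is the common momentum of the six-component WDVV hydrodynamic type
systems with respect to the factorised third-order Hamiltonian operator. -/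
theorem wdvv_momentum
    (b : ℝ → Fin 6 → ℝ) (hb : ContDiff ℝ (⊤ : ℕ∞) b)
    (hb1 : ∀ x, deriv b x 0 ≠ 0) :
    ∀ (i : Fin 6) (x : ℝ),
      -(∑ β, ∑ γ, ∑ s, ΦW⁻¹ β γ * (ΨW (deriv b x))⁻¹ β i *
          deriv (fun y => (ΨW (deriv b y))⁻¹ γ s * ELd PW b s y) x)
        = deriv b x i := by
  have hd : Differentiable ℝ b := hb.differentiable (by simp)
  have hd' : Differentiable ℝ (deriv b) :=
    ((contDiff_infty_iff_deriv.1 hb).2).differentiable (by simp)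
  have hbi (i : Fin 6) : Differentiable ℝ (fun y => b y i) := differentiable_pi.1 hd i
  have hbi' (i : Fin 6) : Differentiable ℝ (fun y => deriv b y i) := differentiable_pi.1 hd' i
  have hΨ (γ s : Fin 6) : Differentiable ℝ (fun y => (ΨW (deriv b y))⁻¹ γ s) := by
    simp only [fun y => ΨW_inv (hb1 y)]
    fin_cases γ <;> fin_cases s <;> simp [ΨWInv] <;> fun_prop (disch := exact hb1 _)
  have hE (s : Fin 6) : Differentiable ℝ (ELd PW b s) := by
    rw [funext (ELd_PW hd s)]
    fin_cases s <;> simp <;> fun_prop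
  intro i x
  have hsum (γ : Fin 6) :
      ∑ s, deriv (fun y => (ΨW (deriv b y))⁻¹ γ s * ELd PW b s y) x =
        ![-deriv b x 5, deriv b x 1, -deriv b x 2, 0, deriv b x 0, -2 * deriv b x 2] γ := by
    rw [← deriv_fun_sum fun s _ => ((hΨ γ s).fun_mul (hE s)) x]
    simp only [fun y => sum_ΨW_inv_mul_ELd_PW hd (hb1 y) γ]
    have h (j : Fin 6) : deriv (fun y => b y j) x = deriv b x j :=
      (hasDerivAt_pi.1 (hd x).hasDerivAt j).deriv
    fin_cases γ <;> simp [h]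
  simp only [← Finset.mul_sum, hsum, ΦW_inv, ΨW_inv (hb1 x)]
  have hx := hb1 x
  fin_cases i <;> simp [ΨWInv, Fin.sum_univ_succ] <;> field_simp <;> ring
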